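/- arXiv:1303.4091 — 2 statements merged into one kernel-verified Lean document; each statement's English description precedes it below -/
import Mathlib

section
/- Let Γ be a graph satisfying the d-dimensional isoperimetric profile IS_d and let 1 ≤ p < d/2 with Hölder conjugate p'. Then there is a constant K' > 0 such that ‖P^{(n)}_x‖_{ℓ^{p'}(X)} ≤ K'·n^{−d/(2p)} for all n ≥ 1, uniformly in x ∈ X; consequently ∑_{i≥0} ‖P^{(i)}_x‖_{ℓ^{p'}(X)} < ∞ for every x, and every g ∈ D^p(Γ) admits a boundary value for the simple random walk (the limit lim_{n→∞} ∑_y P^{(n)}_x(y) g(y) exists for every x). -/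
open scoped BigOperators ENNReal NNReal
open Filter Topology

/-- `f` is `p`-summable (`f ∈ ℓ^p`), for a real exponent `0 < p < ∞`. -/
def lpMem {ι : Type*} (p : ℝ) (f : ι → ℝ) : Prop := Summable fun i => |f i| ^ p

/-- The `ℓ^q`-norm with exponent `q ∈ [1,∞]`, valued in `ℝ≥0∞`. -/
noncomputable def lpENorm {ι : Type*} (q : ℝ≥0∞) (f : ι → ℝ) : ℝ≥0∞ :=
  if q = ⊤ then ⨆ i, (‖f i‖₊ : ℝ≥0∞)
  else (∑' i, (‖f i‖₊ : ℝ≥0∞) ^ q.toReal) ^ (1 / q.toReal)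

/-- A bounded real-valued function. -/
def BoundedFun {ι : Type*} (f : ι → ℝ) : Prop := ∃ M : ℝ, ∀ i, |f i| ≤ M

/-- A graph of bounded (locally finite) valency: each vertex has a finite
set of neighbours, the adjacency is symmetric and there are no loops. -/
structure LFGraph (X : Type*) where
  nbr : X → Finset X
  symm : ∀ x y : X, y ∈ nbr x ↔ x ∈ nbr y
  loopless : ∀ x : X, x ∉ nbr x

namespace LFGraph

variable {X : Type*}

/-- Adjacency. -/
def Adj (G : LFGraph X) (x y : X) : Prop := y ∈ G.nbr x

/-- Connectivity of the graph. -/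
def Conn (G : LFGraph X) : Prop := ∀ x y : X, Relation.ReflTransGen G.Adj x y

/-- The valency is bounded by `D`. -/
def BddVal (G : LFGraph X) (D : ℕ) : Prop := ∀ x : X, (G.nbr x).card ≤ D

/-- The set of oriented edges. -/
abbrev Edge (G : LFGraph X) : Type _ := {e : X × X // e.2 ∈ G.nbr e.1}

/-- The gradient `∇g(x,y) = g(y) - g(x)` of a function on the vertices,
as a function on oriented edges. -/
def grad (G : LFGraph X) (g : X → ℝ) (e : G.Edge) : ℝ := g e.1.2 - g e.1.1

/-- `g ∈ D^p(Γ)`: the gradient of `g` is in `ℓ^p(E)` (`p` finite). -/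
def MemDp (G : LFGraph X) (p : ℝ) (g : X → ℝ) : Prop := lpMem p (G.grad g)

/-- The `ℓ^p(E)`-norm of the gradient of `g`. -/
noncomputable def gradNorm (G : LFGraph X) (p : ℝ) (g : X → ℝ) : ℝ :=
  (∑' e : G.Edge, |G.grad g e| ^ p) ^ (1 / p)

/-- The `D^p`-distance between `g` and `h`, with basepoint `e0`:
`‖∇(g-h)‖_{ℓ^p(E)} + |g(e0) - h(e0)|`. -/
noncomputable def dpDist (G : LFGraph X) (p : ℝ) (e0 : X) (g h : X → ℝ) : ℝ :=
  G.gradNorm p (fun x => g x - h x) + |g e0 - h e0|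

/-- `g` belongs to the `D^p`-closure of `ℓ^p(X) + ℝ·1`, i.e. the class of `g`
in the degree one reduced `ℓ^p`-cohomology is trivial. -/
def InClos (G : LFGraph X) (p : ℝ) (e0 : X) (g : X → ℝ) : Prop :=
  ∀ ε : ℝ, 0 < ε → ∃ (f : X → ℝ) (c : ℝ), lpMem p f ∧
    G.MemDp p (fun x => g x - (f x + c)) ∧
    G.dpDist p e0 g (fun x => f x + c) < ε

/-- `g` belongs to the `D^p`-closure of `ℓ^p(X)` (no constants). -/
def InClosLp (G : LFGraph X) (p : ℝ) (e0 : X) (g : X → ℝ) : Prop :=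
  ∀ ε : ℝ, 0 < ε → ∃ f : X → ℝ, lpMem p f ∧
    G.MemDp p (fun x => g x - f x) ∧
    G.dpDist p e0 g f < ε

open Classical in
/-- The number of (oriented) boundary edges of a finite set `A` of vertices. -/
noncomputable def bdry (G : LFGraph X) (A : Finset X) : ℕ :=
  ∑ x ∈ A, ((G.nbr x).filter fun y => y ∉ A).card

/-- The `d`-dimensional isoperimetric profile `IS_d`. -/
def ISdim (G : LFGraph X) (d : ℝ) : Prop :=
  ∃ κ : ℝ, 0 < κ ∧ ∀ A : Finset X, A.Nonempty →
    (A.card : ℝ) ^ (1 - 1 / d) ≤ κ * (G.bdry A : ℝ)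

/-- The strong isoperimetric profile `IS_ω`. -/
def ISomega (G : LFGraph X) : Prop :=
  ∃ κ : ℝ, 0 < κ ∧ ∀ A : Finset X, A.Nonempty →
    (A.card : ℝ) ≤ κ * (G.bdry A : ℝ)

/-- `h` is harmonic: at every vertex, the average of `h` over the
neighbours equals the value of `h`. -/
def Harmonic (G : LFGraph X) (h : X → ℝ) : Prop :=
  ∀ x : X, ∑ y ∈ G.nbr x, h y = ((G.nbr x).card : ℝ) * h x

/-- The graph is Liouville: every bounded harmonic function is constant. -/
def Liouville (G : LFGraph X) : Prop :=
  ∀ h : X → ℝ, G.Harmonic h → BoundedFun h → ∀ x y : X, h x = h y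

open Classical in
/-- `walk G n x y` is the probability `P^{(n)}_x(y)` that the simple random
walk started at `x` is at `y` at time `n`. -/
noncomputable def walk (G : LFGraph X) : ℕ → X → X → ℝ
  | 0, x, y => if y = x then 1 else 0
  | n + 1, x, y => (∑ z ∈ G.nbr x, walk G n z y) / ((G.nbr x).card : ℝ)

/-- `avg G n g x = ∑_y P^{(n)}_x(y) g(y)`, the expected value of `g` after `n`
steps of the simple random walk started at `x`. -/
noncomputable def avg (G : LFGraph X) (n : ℕ) (g : X → ℝ) (x : X) : ℝ :=
  ∑' y, G.walk n x y * g y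

/-- The Markov operator of the simple random walk: average over the neighbours. -/
noncomputable def pAvg (G : LFGraph X) (f : X → ℝ) (x : X) : ℝ :=
  (∑ y ∈ G.nbr x, f y) / ((G.nbr x).card : ℝ)

/-- Reachability in exactly `n` steps. -/
def reachN (G : LFGraph X) : ℕ → X → X → Prop
  | 0, x, y => y = x
  | n + 1, x, y => ∃ z ∈ G.nbr x, reachN G n z y

/-- The graph distance (the smallest `n` such that `y` is reachable from `x`
in `n` steps). -/
noncomputable def gdist (G : LFGraph X) (x y : X) : ℕ :=
  sInf {n : ℕ | G.reachN n x y}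

/-- `f` is a quasi-isometry between the connected graphs `G` and `H`. -/
def QI {X Y : Type*} (G : LFGraph X) (H : LFGraph Y) (f : X → Y) : Prop :=
  G.Conn ∧ H.Conn ∧ ∃ Λ C : ℝ, 1 ≤ Λ ∧ 0 ≤ C ∧
    (∀ x x' : X, (H.gdist (f x) (f x') : ℝ) ≤ Λ * (G.gdist x x') + C) ∧
    (∀ x x' : X, (G.gdist x x' : ℝ) ≤ Λ * (H.gdist (f x) (f x')) + C) ∧
    ∀ y : Y, ∃ x : X, (H.gdist (f x) y : ℝ) ≤ C

/-- Reachability avoiding the finite set `F`. -/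
def reachAvoid (G : LFGraph X) (F : Finset X) : X → X → Prop :=
  Relation.ReflTransGen fun a b => b ∈ G.nbr a ∧ a ∉ F ∧ b ∉ F

/-- The graph has at most one end: for every finite set `F` of vertices,
the complement of `F` has at most one infinite connected component. -/
def AtMostOneEnd (G : LFGraph X) : Prop :=
  ∀ F : Finset X, ∀ x y : X, x ∉ F → y ∉ F →
    {z | G.reachAvoid F x z}.Infinite → {z | G.reachAvoid F y z}.Infinite →
    G.reachAvoid F x y

end LFGraph

/-- The Cayley graph of a group with respect to a finite symmetric generating
set `S` not containing the identity: the neighbours of `x` are the `s * x`, `s ∈ S`. -/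
def cayley {Γ : Type*} [Group Γ] [DecidableEq Γ] (S : Finset Γ)
    (hsym : ∀ s ∈ S, s⁻¹ ∈ S) (h1 : (1 : Γ) ∉ S) : LFGraph Γ where
  nbr x := S.image fun s => s * x
  symm := by
    intro x y
    simp only [Finset.mem_image]
    constructor
    · rintro ⟨s, hs, rfl⟩
      exact ⟨s⁻¹, hsym s hs, by group⟩
    · rintro ⟨s, hs, rfl⟩
      exact ⟨s⁻¹, hsym s hs, by group⟩
  loopless := by
    intro x hx
    rw [Finset.mem_image] at hx
    obtain ⟨s, hs, hsx⟩ := hx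
    have hs1 : s = 1 := by
      have h' : s * x = 1 * x := by rw [one_mul]; exact hsx
      exact mul_right_cancel h'
    exact h1 (hs1 ▸ hs)

/-- The ball of radius `n` in the word metric given by `S`. -/
def cball {Γ : Type*} [Group Γ] [DecidableEq Γ] (S : Finset Γ) : ℕ → Finset Γ
  | 0 => {1}
  | n + 1 => cball S n ∪ (cball S n).biUnion fun x => S.image fun s => s * x

/-- Amenability of a group, via the Følner condition. -/
def Amenable (Γ : Type*) [Group Γ] [DecidableEq Γ] : Prop :=
  ∀ (T : Finset Γ) (ε : ℝ), 0 < ε → ∃ F : Finset Γ, F.Nonempty ∧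
    ∀ t ∈ T, (((F.image fun x => t * x) \ F).card : ℝ) ≤ ε * (F.card : ℝ)
/-- Interpolation between `ℓ^1` and `ℓ^∞`: a nonnegative function with sum `1` and bounded by `M`
has `ℓ^q`-norm at most `M^{1/p}`, where `q` is the conjugate exponent of `p`. -/
lemma lpENorm_le_of_hasSum_one {ι : Type*} {f : ι → ℝ} (hf : ∀ i, 0 ≤ f i) (h1 : HasSum f 1)
    {M : ℝ} (hM : 0 ≤ M) (hfM : ∀ i, f i ≤ M) {p : ℝ} (hp : 1 ≤ p) {q : ℝ≥0∞}
    (hq : 1 / ENNReal.ofReal p + 1 / q = 1) :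
    lpENorm q f ≤ ENNReal.ofReal (M ^ (1 / p)) := by
  have hp0 : 0 < p := by linarith
  have hcoe : ∀ i, (‖f i‖₊ : ℝ≥0∞) = ENNReal.ofReal (f i) := fun i => by
    rw [← enorm_eq_nnnorm, Real.enorm_eq_ofReal (hf i)]
  have hinv : 1 / ENNReal.ofReal p = ENNReal.ofReal (1 / p) := by
    rw [one_div, one_div, ENNReal.ofReal_inv_of_pos hp0]
  unfold lpENorm
  split_ifs with hqt
  · have h1p : 1 / p = 1 := by
      rw [hinv, hqt] at hq
      simpa using hq
    rw [h1p, Real.rpow_one]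
    exact iSup_le fun i => by rw [hcoe]; exact ENNReal.ofReal_le_ofReal (hfM i)
  · have hq0 : q ≠ 0 := by
      rintro rfl
      simp at hq
    set r := q.toReal with hr
    have hr0 : 0 < r := ENNReal.toReal_pos hq0 hqt
    have hpr : 1 / p + 1 / r = 1 := by
      have hqr : 1 / q = ENNReal.ofReal (1 / r) := by
        rw [one_div, one_div, ENNReal.ofReal_inv_of_pos hr0, hr, ENNReal.ofReal_toReal hqt]
      rw [hinv, hqr, ← ENNReal.ofReal_add (by positivity) (by positivity),
        ENNReal.ofReal_eq_one] at hq
      exact hq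
    have hr1 : 1 ≤ r := by
      have h : 1 / r ≤ 1 := by
        have : 0 < 1 / p := by positivity
        linarith
      rwa [div_le_one hr0] at h
    have hterm : ∀ i, (‖f i‖₊ : ℝ≥0∞) ^ r
        ≤ ENNReal.ofReal (M ^ (r - 1)) * ENNReal.ofReal (f i) := fun i => by
      rw [hcoe, ENNReal.ofReal_rpow_of_nonneg (hf i) hr0.le,
        ← ENNReal.ofReal_mul (by positivity)]
      apply ENNReal.ofReal_le_ofReal
      rcases (hf i).eq_or_lt with h0 | h0
      · rw [← h0, Real.zero_rpow hr0.ne', mul_zero]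
      · have hpow : f i ^ r = f i ^ (r - 1) * f i := by
          rw [← Real.rpow_add_one h0.ne', sub_add_cancel]
        rw [hpow]
        have := Real.rpow_le_rpow h0.le (hfM i) (sub_nonneg.2 hr1)
        gcongr
    have hsum : ∑' i, (‖f i‖₊ : ℝ≥0∞) ^ r ≤ ENNReal.ofReal (M ^ (r - 1)) := by
      refine (ENNReal.tsum_le_tsum hterm).trans ?_
      rw [ENNReal.tsum_mul_left, ← ENNReal.ofReal_tsum_of_nonneg hf h1.summable, h1.tsum_eq,
        ENNReal.ofReal_one, mul_one]
    refine (ENNReal.rpow_le_rpow hsum (by positivity)).trans_eq ?_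
    rw [ENNReal.ofReal_rpow_of_nonneg (by positivity) (by positivity), ← Real.rpow_mul hM]
    congr 2
    have : (r - 1) * (1 / r) = 1 - 1 / r := by field_simp
    linarith

namespace LFGraph

variable {X : Type*} (G : LFGraph X)

lemma ISdim.nbr_nonempty {G : LFGraph X} {d : ℝ} (h : G.ISdim d) (x : X) :
    (G.nbr x).Nonempty := by
  obtain ⟨κ, -, hA⟩ := h
  by_contra hx
  rw [Finset.not_nonempty_iff_eq_empty] at hx
  have := hA {x} (Finset.singleton_nonempty x)
  simp [bdry, hx] at this
  linarith

lemma walk_nonneg (n : ℕ) (x y : X) : 0 ≤ G.walk n x y := by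
  induction n generalizing x with
  | zero => unfold walk; split_ifs <;> norm_num
  | succ n ih => exact div_nonneg (Finset.sum_nonneg fun z _ => ih z) (Nat.cast_nonneg _)

lemma hasSum_walk_mul (g : X → ℝ) (n : ℕ) (x : X) :
    HasSum (fun y => G.walk n x y * g y) (G.pAvg^[n] g x) := by
  induction n generalizing x with
  | zero =>
    have h := hasSum_single (f := fun y => G.walk 0 x y * g y) x
      fun y hy => by simp [walk, hy]
    simpa [walk] using h
  | succ n ih =>
    rw [Function.iterate_succ_apply']
    have h := (hasSum_sum (s := G.nbr x) fun z _ => ih z).div_const ((G.nbr x).card : ℝ)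
    simpa only [walk, pAvg, Finset.sum_mul, div_mul_eq_mul_div] using h

lemma avg_eq_iterate (g : X → ℝ) (n : ℕ) (x : X) : G.avg n g x = G.pAvg^[n] g x :=
  (G.hasSum_walk_mul g n x).tsum_eq

lemma hasSum_walk (hne : ∀ x, (G.nbr x).Nonempty) (n : ℕ) (x : X) :
    HasSum (G.walk n x) 1 := by
  have hone : G.pAvg (fun _ => 1) = fun _ => 1 := by
    ext y
    simp [pAvg, (hne y).card_pos.ne']
  have h := G.hasSum_walk_mul (fun _ => 1) n x
  simpa [Function.iterate_fixed hone] using h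

lemma avg_succ_sub_avg (g : X → ℝ) (n : ℕ) (x : X) :
    G.avg (n + 1) g x - G.avg n g x = G.avg n (fun y => G.pAvg g y - g y) x := by
  have h := (G.hasSum_walk_mul (G.pAvg g) n x).sub (G.hasSum_walk_mul g n x)
  rw [avg_eq_iterate, avg_eq_iterate, Function.iterate_succ_apply, ← h.tsum_eq, avg]
  simp only [mul_sub]

/-- Jensen's inequality for one step of the simple random walk. -/
lemma abs_pAvg_rpow_le {p : ℝ} (hp : 1 ≤ p) (hne : ∀ x, (G.nbr x).Nonempty) (g : X → ℝ) (x : X) :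
    |G.pAvg g x| ^ p ≤ G.pAvg (fun y => |g y| ^ p) x := by
  have hc : (0 : ℝ) < (G.nbr x).card := by exact_mod_cast (hne x).card_pos
  have h := Real.rpow_arith_mean_le_arith_mean_rpow (G.nbr x)
    (fun _ => 1 / ((G.nbr x).card : ℝ)) (fun y => |g y|) (fun _ _ => by positivity)
    (by simp [hc.ne']) (fun _ _ => abs_nonneg _) hp
  rw [← Finset.mul_sum, ← Finset.mul_sum, one_div_mul_eq_div, one_div_mul_eq_div] at h
  refine le_trans ?_ h
  apply Real.rpow_le_rpow (abs_nonneg _) _ (by linarith)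
  rw [pAvg, abs_div, abs_of_pos hc]
  gcongr
  exact Finset.abs_sum_le_sum_abs _ _

lemma pAvg_mono {f g : X → ℝ} (h : ∀ x, f x ≤ g x) (x : X) : G.pAvg f x ≤ G.pAvg g x := by
  unfold pAvg
  gcongr
  exact h _

/-- Jensen's inequality for the simple random walk at time `n`. -/
lemma abs_avg_rpow_le {p : ℝ} (hp : 1 ≤ p) (hne : ∀ x, (G.nbr x).Nonempty) (g : X → ℝ)
    (n : ℕ) (x : X) : |G.avg n g x| ^ p ≤ G.avg n (fun y => |g y| ^ p) x := by
  simp only [avg_eq_iterate]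
  induction n generalizing x with
  | zero => exact le_rfl
  | succ n ih =>
    simp only [Function.iterate_succ_apply']
    exact (G.abs_pAvg_rpow_le hp hne _ x).trans (G.pAvg_mono ih x)

/-- The Laplacian of a function in `D^p` is in `ℓ^p`. -/
lemma MemDp.lpMem_pAvg_sub {G : LFGraph X} {p : ℝ} (hp : 1 ≤ p)
    (hne : ∀ x, (G.nbr x).Nonempty) {g : X → ℝ} (hg : G.MemDp p g) :
    lpMem p fun y => G.pAvg g y - g y := by
  let e : (Σ x, {y // y ∈ G.nbr x}) ≃ G.Edge :=
    { toFun := fun a => ⟨(a.1, a.2.1), a.2.2⟩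
      invFun := fun a => ⟨a.1.1, a.1.2, a.2⟩
      left_inv := fun _ => rfl
      right_inv := fun _ => rfl }
  have hs : Summable fun a : (Σ x, {y // y ∈ G.nbr x}) => |g a.2.1 - g a.1| ^ p :=
    e.summable_iff.2 hg
  refine Summable.of_nonneg_of_le (fun _ => by positivity) (fun x => ?_) hs.sigma
  rw [tsum_fintype]
  have hc : (1 : ℝ) ≤ (G.nbr x).card := by exact_mod_cast (hne x).card_pos
  have hshift : G.pAvg g x - g x = G.pAvg (fun y => g y - g x) x := by
    have : ((G.nbr x).card : ℝ) ≠ 0 := by positivity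
    simp only [pAvg, Finset.sum_sub_distrib, Finset.sum_const, nsmul_eq_mul]
    field_simp
  beta_reduce
  rw [hshift]
  refine (G.abs_pAvg_rpow_le hp hne _ x).trans ?_
  rw [Finset.sum_coe_sort (G.nbr x) fun y => |g y - g x| ^ p]
  exact div_le_self (Finset.sum_nonneg fun _ _ => by positivity) hc

/-- A uniform bound on the transition probabilities bounds the averages of `ℓ^p`-functions. -/
lemma abs_avg_le {p : ℝ} (hp : 1 ≤ p) (hne : ∀ x, (G.nbr x).Nonempty) {h : X → ℝ}
    (hh : lpMem p h) {n : ℕ} {x : X} {M : ℝ} (hM : 0 ≤ M) (hw : ∀ y, G.walk n x y ≤ M) :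
    |G.avg n h x| ≤ M ^ (1 / p) * (∑' y, |h y| ^ p) ^ (1 / p) := by
  have hS : 0 ≤ ∑' y, |h y| ^ p := tsum_nonneg fun _ => by positivity
  have hle : |G.avg n h x| ^ p ≤ M * ∑' y, |h y| ^ p := by
    refine (G.abs_avg_rpow_le hp hne h n x).trans ?_
    rw [avg, ← tsum_mul_left]
    exact (G.hasSum_walk_mul _ n x).summable.tsum_le_tsum
      (fun y => mul_le_mul_of_nonneg_right (hw y) (by positivity)) (hh.mul_left M)
  rw [← Real.mul_rpow hM hS]
  have := Real.rpow_le_rpow (by positivity) hle (by positivity : (0 : ℝ) ≤ 1 / p)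
  rwa [one_div, Real.rpow_rpow_inv (abs_nonneg _) (by linarith), ← one_div] at this

end LFGraph

/-- in a graph with `IS_d` and `1 ≤ p < d/2` (using the standard
heat-kernel bound coming from `IS_d`), the `ℓ^{p'}`-norms of `P^{(n)}_x` decay
like `n^{-d/(2p)}` uniformly in `x`, the series of these norms converges, and
every `g ∈ D^p(Γ)` admits a boundary value for the simple random walk. -/
theorem stmt13 {X : Type*} (G : LFGraph X) (hconn : G.Conn) (D : ℕ) (hval : G.BddVal D)
    (d : ℝ) (hIS : G.ISdim d) (p : ℝ) (hp1 : 1 ≤ p) (hp2 : p < d / 2)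
    (q : ℝ≥0∞) (hq : 1 / ENNReal.ofReal p + 1 / q = 1)
    (K : ℝ) (hK : 0 < K)
    (hheat : ∀ (x y : X) (n : ℕ), 1 ≤ n → G.walk n x y ≤ K * (n : ℝ) ^ (-(d / 2))) :
    (∃ K' : ℝ, 0 < K' ∧ ∀ (x : X) (n : ℕ), 1 ≤ n →
      lpENorm q (G.walk n x) ≤ ENNReal.ofReal (K' * (n : ℝ) ^ (-(d / (2 * p))))) ∧
    (∀ x : X, ∑' i : ℕ, lpENorm q (G.walk i x) ≠ ⊤) ∧
    (∀ g : X → ℝ, G.MemDp p g → ∀ x : X,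
      ∃ L : ℝ, Filter.Tendsto (fun n => G.avg n g x) Filter.atTop (nhds L)) := by
  have hne := hIS.nbr_nonempty
  have hp0 : 0 < p := by linarith
  have hrate : ∀ n : ℕ, (K * (n : ℝ) ^ (-(d / 2))) ^ (1 / p)
      = K ^ (1 / p) * (n : ℝ) ^ (-(d / (2 * p))) := fun n => by
    rw [Real.mul_rpow hK.le (by positivity), ← Real.rpow_mul (Nat.cast_nonneg n)]
    congr 2
    field_simp
  have hdp : -(d / (2 * p)) < -1 := by
    rw [neg_lt_neg_iff, lt_div_iff₀ (by positivity)]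
    linarith
  have hsummable : Summable fun n : ℕ => K ^ (1 / p) * (n : ℝ) ^ (-(d / (2 * p))) :=
    (Real.summable_nat_rpow.2 hdp).mul_left _
  have hbound : ∀ (x : X) (n : ℕ), 1 ≤ n →
      lpENorm q (G.walk n x) ≤ ENNReal.ofReal (K ^ (1 / p) * (n : ℝ) ^ (-(d / (2 * p)))) :=
    fun x n hn => by
      rw [← hrate]
      exact lpENorm_le_of_hasSum_one (G.walk_nonneg n x) (G.hasSum_walk hne n x) (by positivity)
        (fun y => hheat x y n hn) hp1 hq
  refine ⟨⟨K ^ (1 / p), by positivity, hbound⟩, fun x => ?_, fun g hg x => ?_⟩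
  · have h0 : lpENorm q (G.walk 0 x) ≤ ENNReal.ofReal ((1 : ℝ) ^ (1 / p)) :=
      lpENorm_le_of_hasSum_one (G.walk_nonneg 0 x) (G.hasSum_walk hne 0 x) zero_le_one
        (fun y => by unfold LFGraph.walk; split_ifs <;> norm_num) hp1 hq
    rw [tsum_eq_zero_add' ENNReal.summable]
    refine ENNReal.add_ne_top.2 ⟨(h0.trans_lt ENNReal.ofReal_lt_top).ne, ?_⟩
    refine ne_top_of_le_ne_top ?_ (ENNReal.tsum_le_tsum fun n => hbound x (n + 1) (by omega))
    exact ((summable_nat_add_iff 1).2 hsummable).tsum_ofReal_ne_top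
  · have hh := hg.lpMem_pAvg_sub hp1 hne
    set S := (∑' y, |G.pAvg g y - g y| ^ p) ^ (1 / p)
    have hstep : ∀ n : ℕ, dist (G.avg (n + 1) g x) (G.avg (n + 1 + 1) g x)
        ≤ K ^ (1 / p) * ((n + 1 : ℕ) : ℝ) ^ (-(d / (2 * p))) * S := fun n => by
      rw [dist_comm, Real.dist_eq, G.avg_succ_sub_avg, ← hrate]
      exact G.abs_avg_le hp1 hne hh (by positivity) fun y => hheat x y (n + 1) (by omega)
    have hcauchy := cauchySeq_of_dist_le_of_summable _ hstep
      (((summable_nat_add_iff 1).2 hsummable).mul_right S)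
    obtain ⟨L, hL⟩ := cauchySeq_tendsto_of_complete hcauchy
    exact ⟨L, (tendsto_add_atTop_iff_nat 1).1 hL⟩
end

section
/- Assume X is infinite, 1 ≤ p < ∞, and that boundary values for the simple random walk are defined on D^p(Γ) (for every x, ∑_{i≥0} ‖P^{(i)}_x‖_{ℓ^{p'}(X)} < ∞ where p' is the Hölder conjugate of p). If g lies in the D^p-closure of ℓ^p(X) inside D^p(Γ), then the boundary value of g is identically zero: lim_{n→∞} ∑_y P^{(n)}_x(y) g(y) = 0 for every x ∈ X. -/
open scoped BigOperators ENNReal NNReal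
open Filter Topology

theorem lpENorm_ofReal {ι : Type*} {p : ℝ} (hp : 0 ≤ p) (f : ι → ℝ) :
    lpENorm (ENNReal.ofReal p) f = (∑' i, ‖f i‖ₑ ^ p) ^ (1 / p) := by
  simp only [lpENorm, ENNReal.ofReal_ne_top, if_false, ENNReal.toReal_ofReal hp]
  rfl

theorem lpENorm_ofReal_eq_ofReal {ι : Type*} {p : ℝ} (hp : 0 < p) {f : ι → ℝ}
    (hf : lpMem p f) :
    lpENorm (ENNReal.ofReal p) f = ENNReal.ofReal ((∑' i, |f i| ^ p) ^ (1 / p)) := by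
  have hnn : ∀ i, 0 ≤ |f i| ^ p := fun i => by positivity
  rw [lpENorm_ofReal hp.le, ← ENNReal.ofReal_rpow_of_nonneg (tsum_nonneg hnn) (by positivity),
    ENNReal.ofReal_tsum_of_nonneg hnn hf]
  congr 2
  ext i
  rw [← ENNReal.ofReal_rpow_of_nonneg (abs_nonneg _) hp.le, ← Real.norm_eq_abs, ofReal_norm]

theorem enorm_le_lpENorm {ι : Type*} {p : ℝ} (hp : 0 < p) (f : ι → ℝ) (i : ι) :
    ‖f i‖ₑ ≤ lpENorm (ENNReal.ofReal p) f := by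
  rw [lpENorm_ofReal hp.le, one_div, ENNReal.le_rpow_inv_iff hp]
  exact ENNReal.le_tsum i

theorem tsum_enorm_mul_le_lpENorm_mul_lpENorm {ι : Type*} {p : ℝ} (hp : 1 ≤ p) {q : ℝ≥0∞}
    (hq : 1 / ENNReal.ofReal p + 1 / q = 1) (a b : ι → ℝ) :
    ∑' i, ‖a i‖ₑ * ‖b i‖ₑ ≤ lpENorm q a * lpENorm (ENNReal.ofReal p) b := by
  have hp0 : 0 < p := by linarith
  rcases eq_or_ne q ⊤ with rfl | hqt
  · have hp1 : p = 1 := by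
      simpa using hq
    subst hp1
    rw [lpENorm_ofReal zero_le_one]
    simp only [ENNReal.rpow_one, one_div, inv_one, ← ENNReal.tsum_mul_left]
    refine ENNReal.tsum_le_tsum fun i => ?_
    gcongr
    simp only [lpENorm, if_true]
    exact le_iSup (fun i => (‖a i‖₊ : ℝ≥0∞)) i
  · have hq0 : q ≠ 0 := by
      rintro rfl
      simp at hq
    have hqr : 0 < q.toReal := ENNReal.toReal_pos hq0 hqt
    have hconj : q.toReal.HolderConjugate p := by
      rw [Real.holderConjugate_iff]
      have h := congrArg ENNReal.toReal hq
      rw [ENNReal.toReal_add (by simp [hp0]) (by simp [hq0])] at h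
      simp only [one_div, ENNReal.toReal_inv, ENNReal.toReal_ofReal hp0.le,
        ENNReal.toReal_one] at h
      refine ⟨?_, by linarith⟩
      have : 0 < p⁻¹ := by positivity
      exact (inv_lt_one₀ hqr).1 (by linarith)
    rw [lpENorm_ofReal hp0.le, lpENorm, if_neg hqt]
    refine ENNReal.summable.tsum_le_of_sum_le fun s => ?_
    refine (ENNReal.inner_le_Lp_mul_Lq s _ _ hconj).trans ?_
    gcongr
    · exact ENNReal.sum_le_tsum s
    · exact ENNReal.sum_le_tsum s

namespace LFGraph

variable {X : Type*} (G : LFGraph X)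

theorem nbr_nonempty_of_conn [Nontrivial X] (hconn : G.Conn) (x : X) : (G.nbr x).Nonempty := by
  obtain ⟨y, hy⟩ := exists_ne x
  rcases (hconn x y).cases_head with h | ⟨z, hz, -⟩
  · exact absurd h.symm hy
  · exact ⟨z, hz⟩

theorem finite_support_walk (n : ℕ) (x : X) : (Function.support (G.walk n x)).Finite := by
  induction n generalizing x with
  | zero =>
    refine (Set.finite_singleton x).subset fun y hy => ?_
    by_contra h
    exact hy (by simpa [walk] using h)
  | succ n ih =>
    refine ((G.nbr x).finite_toSet.biUnion fun z _ => ih z).subset fun y hy => ?_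
    by_contra h
    simp only [Set.mem_iUnion, not_exists, Function.mem_support, not_not] at h
    exact hy (by simp only [walk, Finset.sum_eq_zero fun z hz => h z hz, zero_div])

theorem summable_walk_mul (n : ℕ) (x : X) (g : X → ℝ) :
    Summable fun y => G.walk n x y * g y :=
  summable_of_hasFiniteSupport <|
    (G.finite_support_walk n x).subset (Function.support_mul_subset_left _ _)

theorem avg_zero (g : X → ℝ) (x : X) : G.avg 0 g x = g x := by
  classical
  simp [avg, walk]

theorem avg_sub (n : ℕ) (g f : X → ℝ) (x : X) :
    G.avg n (fun y => g y - f y) x = G.avg n g x - G.avg n f x := by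
  simp only [avg, mul_sub]
  exact (G.summable_walk_mul n x g).tsum_sub (G.summable_walk_mul n x f)

theorem avg_succ (n : ℕ) (g : X → ℝ) (x : X) : G.avg (n + 1) g x = G.pAvg (G.avg n g) x := by
  simp only [avg, walk, pAvg]
  rw [← Summable.tsum_finsetSum fun z _ => G.summable_walk_mul n z g, ← tsum_div_const]
  congr 1
  ext y
  rw [div_mul_eq_mul_div, Finset.sum_mul]

theorem avg_pAvg (n : ℕ) (g : X → ℝ) (x : X) : G.avg n (G.pAvg g) x = G.avg (n + 1) g x := by
  induction n generalizing x with
  | zero => simp only [avg_succ, avg_zero, pAvg]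
  | succ n ih => rw [avg_succ, avg_succ G (n + 1), funext ih]

theorem enorm_avg_le {p : ℝ} (hp : 1 ≤ p) {q : ℝ≥0∞} (hq : 1 / ENNReal.ofReal p + 1 / q = 1)
    (n : ℕ) (g : X → ℝ) (x : X) :
    ‖G.avg n g x‖ₑ ≤ lpENorm q (G.walk n x) * lpENorm (ENNReal.ofReal p) g := by
  refine enorm_tsum_le_tsum_enorm.trans ?_
  simp only [enorm_mul]
  exact tsum_enorm_mul_le_lpENorm_mul_lpENorm hp hq _ _

theorem tsum_edge (F : X × X → ℝ≥0∞) :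
    ∑' e : G.Edge, F e.1 = ∑' x, ∑ y ∈ G.nbr x, F (x, y) := by
  classical
  refine (tsum_subtype {e : X × X | e.2 ∈ G.nbr e.1} F).trans ?_
  rw [ENNReal.tsum_prod']
  congr 1
  ext x
  rw [tsum_eq_sum (s := G.nbr x) fun y hy => Set.indicator_of_notMem (by simpa using hy) F]
  exact Finset.sum_congr rfl fun y hy => Set.indicator_of_mem (by simpa using hy) F

theorem exists_enorm_pAvg_sub_le {x : X} (hx : (G.nbr x).Nonempty) (g : X → ℝ) :
    ∃ y ∈ G.nbr x, ‖G.pAvg g x - g x‖ₑ ≤ ‖g y - g x‖ₑ := by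
  have hc : (0 : ℝ) < (G.nbr x).card := by exact_mod_cast hx.card_pos
  have h : ∑ _y ∈ G.nbr x, ‖G.pAvg g x - g x‖ ≤ ∑ y ∈ G.nbr x, ‖g y - g x‖ := by
    refine le_trans (le_of_eq ?_) (norm_sum_le _ _)
    rw [Finset.sum_const, nsmul_eq_mul, Finset.sum_sub_distrib, Finset.sum_const, nsmul_eq_mul,
      pAvg]
    nth_rewrite 1 [← Real.norm_of_nonneg hc.le]
    rw [← norm_mul, mul_sub, mul_div_cancel₀ _ hc.ne']
  obtain ⟨y, hy, hle⟩ := Finset.exists_le_of_sum_le hx h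
  exact ⟨y, hy, enorm_le_iff_norm_le.2 hle⟩

theorem lpENorm_pAvg_sub_le (hne : ∀ x, (G.nbr x).Nonempty) {p : ℝ} (hp : 0 < p) (g : X → ℝ) :
    lpENorm (ENNReal.ofReal p) (fun x => G.pAvg g x - g x) ≤
      lpENorm (ENNReal.ofReal p) (G.grad g) := by
  rw [lpENorm_ofReal hp.le, lpENorm_ofReal hp.le]
  gcongr
  simp only [grad]
  rw [G.tsum_edge fun e => ‖g e.2 - g e.1‖ₑ ^ p]
  refine ENNReal.tsum_le_tsum fun x => ?_
  obtain ⟨y, hy, hle⟩ := G.exists_enorm_pAvg_sub_le (hne x) g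
  calc ‖G.pAvg g x - g x‖ₑ ^ p ≤ ‖g y - g x‖ₑ ^ p := by gcongr
    _ ≤ _ := Finset.single_le_sum (f := fun y => ‖g y - g x‖ₑ ^ p) (fun _ _ => zero_le) hy

theorem enorm_avg_le_add (hne : ∀ x, (G.nbr x).Nonempty) {p : ℝ} (hp : 1 ≤ p) {q : ℝ≥0∞}
    (hq : 1 / ENNReal.ofReal p + 1 / q = 1) (n : ℕ) (g : X → ℝ) (x : X) :
    ‖G.avg n g x‖ₑ ≤ ‖g x‖ₑ +
      (∑' i, lpENorm q (G.walk i x)) * lpENorm (ENNReal.ofReal p) (G.grad g) := by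
  have key : ‖G.avg n g x‖ₑ ≤ ‖g x‖ₑ +
      (∑ i ∈ Finset.range n, lpENorm q (G.walk i x)) *
        lpENorm (ENNReal.ofReal p) (G.grad g) := by
    induction n with
    | zero => simp [avg_zero]
    | succ n ih =>
      have h : G.avg (n + 1) g x = G.avg n g x + G.avg n (fun y => G.pAvg g y - g y) x := by
        rw [avg_sub, ← avg_pAvg]
        ring
      rw [h, Finset.sum_range_succ, add_mul, ← add_assoc]
      refine (enorm_add_le _ _).trans (add_le_add ih ?_)
      refine (G.enorm_avg_le hp hq n _ x).trans ?_
      gcongr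
      exact G.lpENorm_pAvg_sub_le hne (by linarith) g
  refine key.trans ?_
  gcongr
  exact ENNReal.sum_le_tsum _

theorem exists_enorm_le_add_of_conn (hconn : G.Conn) {p : ℝ} (hp : 0 < p) (e x : X) :
    ∃ L : ℕ, ∀ h : X → ℝ, ‖h x‖ₑ ≤ ‖h e‖ₑ + L * lpENorm (ENNReal.ofReal p) (G.grad h) := by
  induction hconn e x with
  | refl => exact ⟨0, fun h => by simp⟩
  | @tail y z _ hyz ih =>
    obtain ⟨L, hL⟩ := ih
    refine ⟨L + 1, fun h => ?_⟩
    have hz : h z = h y + G.grad h ⟨(y, z), hyz⟩ := by simp [grad]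
    rw [hz, Nat.cast_add, Nat.cast_one, add_mul, one_mul, ← add_assoc]
    exact (enorm_add_le _ _).trans (add_le_add (hL h) (enorm_le_lpENorm hp _ _))

end LFGraph

/-- if boundary values are defined on `D^p(Γ)` and `g` is in the
`D^p`-closure of `ℓ^p(X)`, then the boundary value of `g` vanishes identically. -/
theorem stmt14 {X : Type*} [Infinite X] (G : LFGraph X) (hconn : G.Conn)
    (D : ℕ) (hval : G.BddVal D)
    (p : ℝ) (hp : 1 ≤ p) (q : ℝ≥0∞) (hq : 1 / ENNReal.ofReal p + 1 / q = 1)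
    (hsum : ∀ x : X, ∑' i : ℕ, lpENorm q (G.walk i x) ≠ ⊤)
    (e0 : X) (g : X → ℝ) (hg : G.MemDp p g) (hclos : G.InClosLp p e0 g) :
    ∀ x : X, Filter.Tendsto (fun n => G.avg n g x) Filter.atTop (nhds 0) := by
  intro x
  have hp0 : 0 < p := by linarith
  obtain ⟨L, hL⟩ := G.exists_enorm_le_add_of_conn hconn hp0 e0 x
  have hwalk := ENNReal.tendsto_atTop_zero_of_tsum_ne_top (hsum x)
  set S := ∑' i : ℕ, lpENorm q (G.walk i x)
  rw [tendsto_zero_iff_enorm_tendsto_zero, ENNReal.tendsto_nhds_zero]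
  intro ε hε
  obtain ⟨δ, hδ, hδε⟩ : ∃ δ : ℝ, 0 < δ ∧ (1 + L + S) * ENNReal.ofReal δ ≤ ε / 2 := by
    have hC : (1 + L + S : ℝ≥0∞) ≠ ⊤ := by simp [S, hsum x]
    have ht : Tendsto (fun δ : ℝ => (1 + L + S) * ENNReal.ofReal δ) (𝓝[>] 0) (𝓝 0) := by
      have h0 : Tendsto ENNReal.ofReal (𝓝[>] 0) (𝓝 0) := by
        simpa using (ENNReal.tendsto_ofReal (tendsto_id (x := 𝓝 (0 : ℝ)))).mono_left
          nhdsWithin_le_nhds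
      simpa using ENNReal.Tendsto.const_mul h0 (Or.inr hC)
    obtain ⟨δ, h1, h2⟩ := ((ENNReal.tendsto_nhds_zero.1 ht (ε / 2)
      (ENNReal.half_pos hε.ne')).and self_mem_nhdsWithin).exists
    exact ⟨δ, h2, h1⟩
  obtain ⟨f, hf, hgf, hdist⟩ := hclos δ hδ
  set h : X → ℝ := fun y => g y - f y
  have hgrad_nonneg : 0 ≤ G.gradNorm p h := by
    unfold LFGraph.gradNorm
    positivity
  have hdist' : G.gradNorm p h + |h e0| < δ := hdist
  have hE : lpENorm (ENNReal.ofReal p) (G.grad h) ≤ ENNReal.ofReal δ := by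
    rw [lpENorm_ofReal_eq_ofReal hp0 hgf]
    refine ENNReal.ofReal_le_ofReal (le_trans (le_refl (G.gradNorm p h)) ?_)
    linarith [abs_nonneg (h e0)]
  have he : ‖h e0‖ₑ ≤ ENNReal.ofReal δ := by
    rw [← ofReal_norm, Real.norm_eq_abs]
    exact ENNReal.ofReal_le_ofReal (by linarith)
  have hf_top : lpENorm (ENNReal.ofReal p) f ≠ ⊤ := by
    rw [lpENorm_ofReal_eq_ofReal hp0 hf]
    exact ENNReal.ofReal_ne_top
  have hfw : Tendsto (fun n => lpENorm q (G.walk n x) * lpENorm (ENNReal.ofReal p) f)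
      atTop (𝓝 0) := by
    simpa using ENNReal.Tendsto.mul_const hwalk (Or.inr hf_top)
  have hh (n : ℕ) : ‖G.avg n h x‖ₑ ≤ ε / 2 :=
    calc ‖G.avg n h x‖ₑ
        ≤ ‖h x‖ₑ + S * lpENorm (ENNReal.ofReal p) (G.grad h) :=
          G.enorm_avg_le_add (G.nbr_nonempty_of_conn hconn) hp hq n h x
      _ ≤ ENNReal.ofReal δ + L * ENNReal.ofReal δ + S * ENNReal.ofReal δ := by
          gcongr
          exact (hL h).trans (by gcongr)
      _ = (1 + L + S) * ENNReal.ofReal δ := by ring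
      _ ≤ ε / 2 := hδε
  filter_upwards [ENNReal.tendsto_nhds_zero.1 hfw (ε / 2) (ENNReal.half_pos hε.ne')] with n hn
  have hsplit : G.avg n g x = G.avg n f x + G.avg n h x := by
    rw [LFGraph.avg_sub]
    ring
  calc ‖G.avg n g x‖ₑ ≤ ‖G.avg n f x‖ₑ + ‖G.avg n h x‖ₑ := hsplit ▸ enorm_add_le _ _
    _ ≤ ε / 2 + ε / 2 := add_le_add ((G.enorm_avg_le hp hq n f x).trans hn) (hh n)
    _ = ε := ENNReal.add_halves ε
end
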